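/- arXiv:2510.05595 — 2 statements merged into one kernel-verified Lean document; each statement's English description precedes it below -/
import Mathlib

section
/- Let a and b be positive integers with a ∣ b. Let S = {x₁, …, xₙ} be a gcd-closed set of n distinct positive integers satisfying condition 𝒢 with max_{x∈S} |G_S(x)| = 3. Then the a-th power LCM matrix [S^a] divides the b-th power LCM matrix [S^b] in M_n(ℤ); in fact there exists an n × n integer matrix A such that [S^b] = A·[S^a]. -/
open Finset

def gcdClosed (S : Finset ℕ) : Prop := ∀ x ∈ S, ∀ y ∈ S, Nat.gcd x y ∈ S

/-- The set of greatest-type divisors of `x` in `S`. -/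
def GTD (S : Finset ℕ) (x : ℕ) : Finset ℕ :=
  S.filter fun d => d < x ∧ d ∣ x ∧ ∀ y ∈ S, d ∣ y → y ∣ x → y = d ∨ y = x

/-- The element `x` satisfies condition 𝒢 with respect to `S`. -/
def condGAt (S : Finset ℕ) (x : ℕ) : Prop :=
  ∀ y₁ ∈ GTD S x, ∀ y₂ ∈ GTD S x, y₁ ≠ y₂ →
    Nat.lcm y₁ y₂ = x ∧ Nat.gcd y₁ y₂ ∈ GTD S y₁ ∧ Nat.gcd y₁ y₂ ∈ GTD S y₂

/-- The set `S` satisfies condition 𝒢. -/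
def condG (S : Finset ℕ) : Prop := ∀ x ∈ S, condGAt S x

/-- `c_{ij}`: the sum of `μ(d)` over positive integers `d` with `d·x_i ∣ x_j` and
`d·x_i ∤ x_t` for every `x_t ∈ S` with `x_t < x_j`. -/
def cMat {n : ℕ} (x : Fin n → ℕ) (i j : Fin n) : ℤ :=
  ∑ d ∈ (x j).divisors.filter
      (fun d => d * x i ∣ x j ∧ ∀ t : Fin n, x t < x j → ¬ d * x i ∣ x t),
    ArithmeticFunction.moebius d

/-- `α_{ξ_a}(x_k)`: the sum of `(ξ_a * μ)(d)` over divisors `d` of `x_k` with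
`d ∤ x_t` for every `x_t ∈ S` with `x_t < x_k`. -/
def alphaXi {n : ℕ} (a : ℕ) (x : Fin n → ℕ) (k : Fin n) : ℤ :=
  ∑ d ∈ (x k).divisors.filter (fun d => ∀ t : Fin n, x t < x k → ¬ d ∣ x t),
    ∑ e ∈ d.divisors, (e : ℤ) ^ a * ArithmeticFunction.moebius (d / e)

/-- `α_{1/ξ_a}(x_k)`: the sum of `((1/ξ_a) * μ)(d)` over divisors `d` of `x_k` with
`d ∤ x_t` for every `x_t ∈ S` with `x_t < x_k`. -/
def alphaInvXi {n : ℕ} (a : ℕ) (x : Fin n → ℕ) (k : Fin n) : ℚ :=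
  ∑ d ∈ (x k).divisors.filter (fun d => ∀ t : Fin n, x t < x k → ¬ d ∣ x t),
    ∑ e ∈ d.divisors, ((e : ℚ) ^ a)⁻¹ * ((ArithmeticFunction.moebius (d / e) : ℤ) : ℚ)

/-- The greatest common divisor of `x` and all elements of `T`. -/
def meetWith (x : ℕ) (T : Finset ℕ) : ℕ := Nat.gcd x (T.gcd id)

/-- The alternating sum of `F` over the meets of `x` with the sets of greatest-type divisors of `x`;
on a gcd-closed set this is the Möbius inverse of `F`. -/
def altSum (S : Finset ℕ) (F : ℕ → ℚ) (x : ℕ) : ℚ :=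
  ∑ T ∈ (GTD S x).powerset, (-1) ^ #T * F (meetWith x T)

lemma dvd_meetWith {d x : ℕ} {T : Finset ℕ} : d ∣ meetWith x T ↔ d ∣ x ∧ ∀ y ∈ T, d ∣ y := by
  simp [meetWith, Nat.dvd_gcd_iff, Finset.dvd_gcd_iff]

lemma meetWith_dvd (x : ℕ) (T : Finset ℕ) : meetWith x T ∣ x := Nat.gcd_dvd_left _ _

lemma meetWith_insert (x y : ℕ) (T : Finset ℕ) :
    meetWith x (insert y T) = Nat.gcd (meetWith x T) y := by
  apply Nat.dvd_antisymm
  · have h := dvd_meetWith.mp (dvd_refl (meetWith x (insert y T)))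
    exact Nat.dvd_gcd (dvd_meetWith.mpr ⟨h.1, fun z hz => h.2 z (mem_insert_of_mem hz)⟩)
      (h.2 y (mem_insert_self _ _))
  · have h := dvd_meetWith.mp (Nat.gcd_dvd_left (meetWith x T) y)
    refine dvd_meetWith.mpr ⟨h.1, fun z hz => ?_⟩
    rcases mem_insert.mp hz with rfl | hz
    · exact Nat.gcd_dvd_right _ _
    · exact h.2 z hz

lemma meetWith_empty (x : ℕ) : meetWith x ∅ = x := by simp [meetWith]

lemma gcd_meetWith (m x : ℕ) (T : Finset ℕ) :
    Nat.gcd m (meetWith x T) = Nat.gcd (Nat.gcd m x) (meetWith x T) := by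
  rw [Nat.gcd_assoc, Nat.gcd_eq_right (meetWith_dvd x T)]

lemma meetWith_mem {S : Finset ℕ} (hS : gcdClosed S) {x : ℕ} (hx : x ∈ S) {T : Finset ℕ}
    (hT : T ⊆ S) : meetWith x T ∈ S := by
  induction T using Finset.induction_on with
  | empty => rwa [meetWith_empty]
  | insert y T _ ih =>
    rw [meetWith_insert]
    exact hS _ (ih fun z hz => hT (mem_insert_of_mem hz)) _ (hT (mem_insert_self _ _))

/-- If the cofactors `r y` of `gcd g y` in `g` are pairwise coprime, then their product is the
cofactor of the meet. -/
lemma gcd_meetWith_mul_prod {g x : ℕ} (hg : g ∣ x) {r : ℕ → ℕ} (T : Finset ℕ)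
    (hr : ∀ y ∈ T, Nat.gcd g y * r y = g)
    (hco : ∀ y ∈ T, ∀ z ∈ T, y ≠ z → Nat.Coprime (r y) (r z)) :
    Nat.gcd g (meetWith x T) * ∏ y ∈ T, r y = g := by
  induction T using Finset.induction_on with
  | empty => simp [meetWith_empty, Nat.gcd_eq_left hg]
  | insert y T hy ih =>
    have ih := ih (fun z hz => hr z (mem_insert_of_mem hz))
      (fun z hz w hw => hco z (mem_insert_of_mem hz) w (mem_insert_of_mem hw))
    have hyg := hr y (mem_insert_self _ _)
    have hc : Nat.Coprime (r y) (∏ z ∈ T, r z) := Nat.Coprime.prod_right fun z hz =>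
      hco y (mem_insert_self _ _) z (mem_insert_of_mem hz) (by rintro rfl; exact hy hz)
    rw [prod_insert hy, meetWith_insert]
    have key : Nat.gcd g (Nat.gcd (meetWith x T) y)
        = Nat.gcd (Nat.gcd g (meetWith x T)) (Nat.gcd g y) := by
      refine Nat.dvd_left_iff_eq.mp fun d => ?_
      simp only [Nat.dvd_gcd_iff]
      tauto
    rw [key, ← Nat.gcd_mul_right]
    calc Nat.gcd (Nat.gcd g (meetWith x T) * (r y * ∏ z ∈ T, r z))
          (Nat.gcd g y * (r y * ∏ z ∈ T, r z))
        = Nat.gcd (g * r y) (g * ∏ z ∈ T, r z) := by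
          congr 1
          · rw [mul_left_comm, ih, mul_comm]
          · rw [← mul_assoc, hyg]
      _ = g := by rw [Nat.gcd_mul_left, hc, mul_one]

lemma mem_GTD {S : Finset ℕ} {x d : ℕ} : d ∈ GTD S x ↔
    d ∈ S ∧ d < x ∧ d ∣ x ∧ ∀ y ∈ S, d ∣ y → y ∣ x → y = d ∨ y = x := by
  simp [GTD]

lemma exists_mem_GTD {S : Finset ℕ} {x g : ℕ} (hx : 0 < x) (hg : g ∈ S) (hgx : g ∣ x)
    (hne : g ≠ x) : ∃ y ∈ GTD S x, g ∣ y := by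
  obtain ⟨y, hy, hmax⟩ := exists_max_image (S.filter fun y => g ∣ y ∧ y ∣ x ∧ y ≠ x) id
    ⟨g, by simp [hg, hgx, hne]⟩
  simp only [mem_filter, id] at hy hmax
  obtain ⟨hyS, hgy, hyx, hyne⟩ := hy
  refine ⟨y, mem_GTD.mpr ⟨hyS, lt_of_le_of_ne (Nat.le_of_dvd hx hyx) hyne, hyx, ?_⟩, hgy⟩
  intro z hz hyz hzx
  by_contra! h
  have hle := hmax z ⟨hz, hgy.trans hyz, hzx, h.2⟩
  exact h.1 (le_antisymm hle (Nat.le_of_dvd (Nat.pos_of_dvd_of_pos hzx hx) hyz))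

lemma sum_powerset_altSum {S : Finset ℕ} {x : ℕ} (hx : 0 < x) (hxS : x ∈ S) (f : ℕ → ℚ) :
    ∑ T ∈ (GTD S x).powerset, (-1) ^ #T * ∑ l ∈ S with l ∣ meetWith x T, f l = f x := by
  have h1 : ∀ T ∈ (GTD S x).powerset,
      (-1 : ℚ) ^ #T * ∑ l ∈ S with l ∣ meetWith x T, f l
        = ∑ l ∈ S with l ∣ x, f l * ∏ y ∈ T, (-(if l ∣ y then 1 else 0)) := by
    intro T _
    have : (S.filter fun l => l ∣ meetWith x T)
        = (S.filter fun l => l ∣ x).filter fun l => ∀ y ∈ T, l ∣ y := by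
      ext l; simp [dvd_meetWith, and_assoc]
    rw [this, sum_filter (fun l => ∀ y ∈ T, l ∣ y), mul_sum]
    refine sum_congr rfl fun l _ => ?_
    rw [prod_neg, prod_ite_zero]
    split_ifs <;> simp [mul_comm]
  rw [sum_congr rfl h1, sum_comm]
  simp_rw [← mul_sum, ← prod_one_add]
  rw [sum_eq_single x]
  · rw [prod_eq_one, mul_one]
    intro y hy
    have := (mem_GTD.mp hy).2
    rw [if_neg]; · simp
    intro h
    exact absurd (Nat.dvd_antisymm h this.2.1) this.1.ne'
  · intro l hl hne
    rw [mem_filter] at hl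
    obtain ⟨y, hy, hly⟩ := exists_mem_GTD hx hl.1 hl.2 hne
    rw [prod_eq_zero hy (by simp [hly]), mul_zero]
  · intro h
    simp [hxS] at h

lemma sum_altSum {S : Finset ℕ} (hS : gcdClosed S) (hpos : ∀ x ∈ S, 0 < x) (F : ℕ → ℚ) {x : ℕ}
    (hx : x ∈ S) : ∑ l ∈ S with l ∣ x, altSum S F l = F x := by
  induction x using Nat.strong_induction_on with
  | _ x ih =>
    have h := sum_powerset_altSum (hpos x hx) hx (altSum S F)
    conv_rhs at h => rw [altSum]
    rw [← sub_eq_zero, ← sum_sub_distrib, sum_eq_single ∅] at h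
    · simp only [meetWith_empty, card_empty, pow_zero, one_mul] at h
      linarith
    · intro T hT hne
      rw [mem_powerset] at hT
      obtain ⟨y, hy⟩ := nonempty_iff_ne_empty.mpr hne
      have hyx := mem_GTD.mp (hT hy)
      have hdvd := (dvd_meetWith.mp (dvd_refl (meetWith x T))).2 y hy
      rw [ih _ ((Nat.le_of_dvd (hpos y hyx.1) hdvd).trans_lt hyx.2.1)
        (meetWith_mem hS hx fun z hz => (mem_GTD.mp (hT hz)).1), sub_self]
    · simp

lemma div_gcd_eq_one_or {S : Finset ℕ} (hpos : ∀ x ∈ S, 0 < x)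
    (hG : condG S) {x g y : ℕ} (hx : x ∈ S) (hg : g ∈ S) (hgx : g ∣ x) (hy : y ∈ GTD S x) :
    g ∣ y ∨ Nat.gcd g y * (x / y) = g := by
  induction x using Nat.strong_induction_on generalizing y with
  | _ x ih =>
    have hyx := mem_GTD.mp hy
    by_cases hne : g = x
    · subst hne
      right
      rw [Nat.gcd_eq_right hyx.2.2.1, Nat.mul_div_cancel' hyx.2.2.1]
    obtain ⟨w, hw, hgw⟩ := exists_mem_GTD (hpos x hx) hg hgx hne
    by_cases hwy : w = y
    · exact .inl (hwy ▸ hgw)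
    have hwx := mem_GTD.mp hw
    obtain ⟨hl, hgm, -⟩ := hG x hx w hw y hy hwy
    have hq : w / Nat.gcd w y = x / y := by
      have := Nat.gcd_mul_lcm w y
      rw [hl] at this
      refine Nat.div_eq_of_eq_mul_right (Nat.gcd_pos_of_pos_left _ (hpos w hwx.1)) ?_
      refine Nat.eq_of_mul_eq_mul_right (hpos y hyx.1) ?_
      rw [mul_assoc, Nat.div_mul_cancel hyx.2.2.1, this]
    have hgg : Nat.gcd g (Nat.gcd w y) = Nat.gcd g y := by
      rw [← Nat.gcd_assoc, Nat.gcd_eq_left hgw]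
    rcases ih w hwx.2.1 hwx.1 hgw hgm with h | h
    · exact .inl (h.trans (Nat.gcd_dvd_right _ _))
    · right
      rwa [hgg, hq] at h

lemma coprime_div_of_mem_GTD {S : Finset ℕ} (hpos : ∀ x ∈ S, 0 < x) (hG : condG S) {x y z : ℕ}
    (hx : x ∈ S) (hy : y ∈ GTD S x) (hz : z ∈ GTD S x) (hne : y ≠ z) :
    Nat.Coprime (x / y) (x / z) := by
  have hx0 := hpos x hx
  have hyx := (mem_GTD.mp hy).2.2.1
  have hzx := (mem_GTD.mp hz).2.2.1
  have hl := (hG x hx y hy z hz hne).1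
  set d := Nat.gcd (x / y) (x / z) with hd
  have h1 : y * d ∣ x := by
    conv_rhs => rw [← Nat.mul_div_cancel' hyx]
    exact mul_dvd_mul_left _ (Nat.gcd_dvd_left _ _)
  have h2 : z * d ∣ x := by
    conv_rhs => rw [← Nat.mul_div_cancel' hzx]
    exact mul_dvd_mul_left _ (Nat.gcd_dvd_right _ _)
  have h3 : x * d ∣ x * 1 := by
    rw [mul_one]
    conv_lhs => rw [← hl, ← Nat.lcm_mul_right]
    exact Nat.lcm_dvd h1 h2
  exact Nat.dvd_one.mp (Nat.dvd_of_mul_dvd_mul_left hx0 h3)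

lemma meetWith_mul_prod {S : Finset ℕ} (hpos : ∀ x ∈ S, 0 < x) (hG : condG S) {x : ℕ}
    (hx : x ∈ S) {T : Finset ℕ} (hT : T ⊆ GTD S x) :
    meetWith x T * ∏ y ∈ T, x / y = x := by
  have := gcd_meetWith_mul_prod (dvd_refl x) (r := fun y => x / y) T
    (fun y hy => by
      have := (mem_GTD.mp (hT hy)).2.2.1
      rw [Nat.gcd_eq_right this, Nat.mul_div_cancel' this])
    (fun y hy z hz => coprime_div_of_mem_GTD hpos hG hx (hT hy) (hT hz))
  rwa [Nat.gcd_eq_right (meetWith_dvd x T)] at this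

/-- Evaluation of the alternating sum of `u ↦ lcm(m, u)^(a+c) / u^a` at `x` in product form. -/
lemma altSum_lcm_pow {S : Finset ℕ} (hS : gcdClosed S) (hpos : ∀ x ∈ S, 0 < x) (hG : condG S)
    (a c : ℕ) {m x : ℕ} (hm : m ∈ S) (hx : x ∈ S) :
    altSum S (fun u => (Nat.lcm m u : ℚ) ^ (a + c) / (u : ℚ) ^ a) x
      = (Nat.lcm m x : ℚ) ^ (a + c) / (x : ℚ) ^ a * ∏ y ∈ GTD S x,
        (1 - if Nat.gcd m x ∣ y then 1 / ((x / y : ℕ) : ℚ) ^ c else ((x / y : ℕ) : ℚ) ^ a) := by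
  have hx0 := hpos x hx
  set g := Nat.gcd m x with hgdef
  have hgS : g ∈ S := hS m hm x hx
  have hgx : g ∣ x := Nat.gcd_dvd_right _ _
  have hg0 := hpos g hgS
  let r : ℕ → ℕ := fun y => if g ∣ y then 1 else x / y
  have hr : ∀ y ∈ GTD S x, Nat.gcd g y * r y = g := by
    intro y hy
    by_cases h : g ∣ y
    · simp [r, h, Nat.gcd_eq_left h]
    · simpa [r, h] using div_gcd_eq_one_or hpos hG hx hgS hgx hy
  have hrd : ∀ y, r y ∣ x / y := by
    intro y
    by_cases h : g ∣ y <;> simp [r, h]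
  have hpp : ∀ y ∈ GTD S x, (0 : ℚ) < ((x / y : ℕ) : ℚ) := by
    intro y hy
    have := mem_GTD.mp hy
    exact_mod_cast Nat.div_pos this.2.1.le (hpos y this.1)
  have hcop := fun y hy z hz hne =>
    coprime_div_of_mem_GTD (y := y) (z := z) hpos hG hx hy hz hne
  rw [altSum]
  have h1 : ∀ y ∈ GTD S x,
      (1 - if g ∣ y then 1 / ((x / y : ℕ) : ℚ) ^ c else ((x / y : ℕ) : ℚ) ^ a)
        = 1 + -((r y : ℚ) ^ (a + c) / ((x / y : ℕ) : ℚ) ^ c) := by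
    intro y hy
    have := (hpp y hy).ne'
    by_cases h : g ∣ y
    · simp [r, h, sub_eq_add_neg]
    · simp only [r, h, if_false, sub_eq_add_neg]
      rw [pow_add, mul_div_cancel_right₀ _ (pow_ne_zero _ this)]
  rw [prod_congr rfl h1, prod_one_add, mul_sum]
  refine sum_congr rfl fun T hT => ?_
  rw [mem_powerset] at hT
  have hz := meetWith_mul_prod hpos hG hx hT
  have hg' : Nat.gcd m (meetWith x T) * ∏ y ∈ T, r y = g := by
    rw [gcd_meetWith]
    exact gcd_meetWith_mul_prod hgx T (fun y hy => hr y (hT hy)) fun y hy z hz hne =>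
      (hcop y (hT hy) z (hT hz) hne).of_dvd (hrd y) (hrd z)
  have hl1 := Nat.gcd_mul_lcm m x
  have hl2 := Nat.gcd_mul_lcm m (meetWith x T)
  rw [← hgdef] at hl1
  rw [prod_neg, prod_div_distrib, prod_pow, prod_pow]
  have hz0 : meetWith x T ≠ 0 := by intro h; rw [h] at hz; omega
  have hP0 : ∏ y ∈ T, x / y ≠ 0 := by intro h; rw [h] at hz; omega
  have hk0 : Nat.gcd m (meetWith x T) ≠ 0 := by intro h; rw [h] at hg'; omega
  rw [← Nat.cast_prod, ← Nat.cast_prod]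
  generalize meetWith x T = z at *
  generalize ∏ y ∈ T, x / y = P at *
  generalize ∏ y ∈ T, r y = R at *
  generalize Nat.lcm m x = L at *
  generalize Nat.lcm m z = l at *
  generalize Nat.gcd m z = k at *
  have hlP : l * P = L * R := by
    refine Nat.eq_of_mul_eq_mul_left (Nat.pos_of_ne_zero hk0) ?_
    calc k * (l * P) = m * (z * P) := by rw [← mul_assoc, hl2, mul_assoc]
      _ = k * R * L := by rw [hz, ← hl1, hg']
      _ = k * (L * R) := by ring
  have hlQ : (l : ℚ) * P = L * R := by exact_mod_cast hlP
  have hzQ : (x : ℚ) = z * P := by exact_mod_cast hz.symm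
  have : (z : ℚ) ≠ 0 := by exact_mod_cast hz0
  have : (P : ℚ) ≠ 0 := by exact_mod_cast hP0
  have e : (l : ℚ) ^ (a + c) * (P : ℚ) ^ (a + c) = (L : ℚ) ^ (a + c) * (R : ℚ) ^ (a + c) := by
    rw [← mul_pow, hlQ, mul_pow]
  rw [hzQ, mul_pow]
  field_simp
  linear_combination e

lemma altSum_one_div_pow {S : Finset ℕ} (hS : gcdClosed S) (hpos : ∀ x ∈ S, 0 < x)
    (hG : condG S) (a : ℕ) {x : ℕ} (hx : x ∈ S) :
    altSum S (fun u => 1 / (u : ℚ) ^ a) x * (x : ℚ) ^ a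
      = ∏ y ∈ GTD S x, (1 - ((x / y : ℕ) : ℚ) ^ a) := by
  have h := altSum_lcm_pow hS hpos hG a 0 hx hx
  have hx0 : (x : ℚ) ≠ 0 := by exact_mod_cast (hpos x hx).ne'
  rw [Nat.lcm_self, Nat.gcd_self, add_zero, div_self (pow_ne_zero _ hx0), one_mul] at h
  have hprod : ∏ y ∈ GTD S x, (1 - ((x / y : ℕ) : ℚ) ^ a) = ∏ y ∈ GTD S x,
      (1 - if x ∣ y then 1 / ((x / y : ℕ) : ℚ) ^ 0 else ((x / y : ℕ) : ℚ) ^ a) := by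
    refine prod_congr rfl fun y hy => ?_
    have := mem_GTD.mp hy
    rw [if_neg (Nat.not_dvd_of_pos_of_lt (hpos y this.1) this.2.1)]
  rw [hprod, ← h, altSum, altSum, sum_mul]
  refine sum_congr rfl fun T _ => ?_
  rw [Nat.lcm_eq_left (meetWith_dvd x T)]
  ring

lemma exists_altSum_lcm_pow_eq_mul {S : Finset ℕ} (hS : gcdClosed S) (hpos : ∀ x ∈ S, 0 < x)
    (hG : condG S) {a c : ℕ} (hac : a ∣ c) {m x : ℕ} (hm : m ∈ S) (hx : x ∈ S) :
    ∃ e : ℤ, altSum S (fun u => (Nat.lcm m u : ℚ) ^ (a + c) / (u : ℚ) ^ a) x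
      = altSum S (fun u => 1 / (u : ℚ) ^ a) x * ((x : ℚ) ^ a * e) := by
  have ht : ∀ p : ℕ, ∃ t : ℤ, (p : ℤ) ^ c - 1 = ((p : ℤ) ^ a - 1) * t := by
    obtain ⟨k, rfl⟩ := hac
    intro p
    rw [pow_mul]
    have h := sub_dvd_pow_sub_pow ((p : ℤ) ^ a) 1 k
    rwa [one_pow] at h
  choose t ht using ht
  set T := (GTD S x).filter fun y => Nat.gcd m x ∣ y
  have hQx : ∏ y ∈ T, x / y ∣ x :=
    Dvd.intro_left _ (meetWith_mul_prod hpos hG hx (filter_subset _ _))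
  have hxL : x ∣ Nat.lcm m x := Nat.dvd_lcm_right _ _
  obtain ⟨q, hq⟩ : x ^ a * (∏ y ∈ T, x / y) ^ c ∣ Nat.lcm m x ^ (a + c) := by
    rw [pow_add]
    exact mul_dvd_mul (pow_dvd_pow_of_dvd hxL _) (pow_dvd_pow_of_dvd (hQx.trans hxL) _)
  have hx0 : (x : ℚ) ≠ 0 := by exact_mod_cast (hpos x hx).ne'
  have hQ0 : ((∏ y ∈ T, x / y : ℕ) : ℚ) ≠ 0 := by
    exact_mod_cast (Nat.pos_of_dvd_of_pos hQx (hpos x hx)).ne'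
  have hprod : ∏ y ∈ GTD S x,
      (1 - if Nat.gcd m x ∣ y then 1 / ((x / y : ℕ) : ℚ) ^ c else ((x / y : ℕ) : ℚ) ^ a)
      = (∏ y ∈ GTD S x, (1 - ((x / y : ℕ) : ℚ) ^ a)) *
        ((∏ y ∈ T, -(t (x / y) : ℚ)) / ((∏ y ∈ T, x / y : ℕ) : ℚ) ^ c) := by
    rw [Nat.cast_prod, ← prod_pow, ← prod_div_distrib, prod_filter, ← prod_mul_distrib]
    refine prod_congr rfl fun y hy => ?_
    split_ifs
    · have hy' := mem_GTD.mp hy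
      have hp : ((x / y : ℕ) : ℚ) ≠ 0 := by
        exact_mod_cast (Nat.div_pos hy'.2.1.le (hpos y hy'.1)).ne'
      have h : ((x / y : ℕ) : ℚ) ^ c - 1 = (((x / y : ℕ) : ℚ) ^ a - 1) * t (x / y) := by
        exact_mod_cast ht (x / y)
      generalize ((x / y : ℕ) : ℚ) = p at *
      field_simp
      linear_combination h
    · rw [mul_one]
  refine ⟨q * ∏ y ∈ T, -t (x / y), ?_⟩
  have hq' : (Nat.lcm m x : ℚ) ^ (a + c)
      = (x : ℚ) ^ a * ((∏ y ∈ T, x / y : ℕ) : ℚ) ^ c * q := by exact_mod_cast hq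
  rw [altSum_lcm_pow hS hpos hG a c hm hx, hprod, ← mul_assoc (altSum _ _ _),
    altSum_one_div_pow hS hpos hG a hx, hq']
  simp only [Int.cast_mul, Int.cast_prod, Int.cast_neg, Int.cast_natCast]
  field_simp

/-- Triangular systems with divisibility-compatible right-hand sides have integral solutions. -/
lemma exists_sum_multiples_eq (S : Finset ℕ) (hpos : ∀ x ∈ S, 0 < x) (a : ℕ) (e : ℕ → ℤ) :
    ∃ c : ℕ → ℤ, ∀ l ∈ S, ∑ k ∈ S with l ∣ k, c k * (k : ℤ) ^ a = (l : ℤ) ^ a * e l := by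
  induction S using Finset.induction_on_min with
  | empty => exact ⟨0, by simp⟩
  | insert l S hl ih =>
    obtain ⟨c, hc⟩ := ih fun x hx => hpos x (mem_insert_of_mem hx)
    have hlS : l ∉ S := fun h => (hl l h).false
    have hl0 := hpos l (mem_insert_self _ _)
    have hdvd : (l : ℤ) ^ a ∣ ∑ k ∈ S with l ∣ k, c k * (k : ℤ) ^ a := by
      refine dvd_sum fun k hk => Dvd.dvd.mul_left (pow_dvd_pow_of_dvd ?_ _) _
      exact_mod_cast (mem_filter.mp hk).2
    obtain ⟨q, hq⟩ := hdvd
    have hsum : ∀ d, ∑ k ∈ S with d ∣ k, Function.update c l (e l - q) k * (k : ℤ) ^ a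
        = ∑ k ∈ S with d ∣ k, c k * (k : ℤ) ^ a := fun d => sum_congr rfl fun k hk => by
      rw [Function.update_of_ne]
      rintro rfl
      exact hlS (mem_filter.mp hk).1
    refine ⟨Function.update c l (e l - q), fun d hd => ?_⟩
    rw [filter_insert]
    rcases mem_insert.mp hd with rfl | hd
    · rw [if_pos dvd_rfl, sum_insert (by simp [hlS]), hsum, hq, Function.update_self]
      ring
    · rw [if_neg fun h => absurd (Nat.le_of_dvd hl0 h) (hl d hd).not_ge, hsum, hc d hd]

lemma exists_sum_lcm_pow_eq {S : Finset ℕ} (hS : gcdClosed S) (hpos : ∀ x ∈ S, 0 < x)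
    (hG : condG S) {a b : ℕ} (hb : 0 < b) (hab : a ∣ b) {m : ℕ} (hm : m ∈ S) :
    ∃ c : ℕ → ℤ, ∀ u ∈ S, (Nat.lcm m u : ℤ) ^ b = ∑ k ∈ S, c k * (Nat.lcm k u : ℤ) ^ a := by
  obtain ⟨d, rfl⟩ := Nat.exists_eq_add_of_le (Nat.le_of_dvd hb hab)
  have had : a ∣ d := (Nat.dvd_add_right dvd_rfl).mp hab
  have he : ∀ x, ∃ e : ℤ, x ∈ S →
      altSum S (fun u => (Nat.lcm m u : ℚ) ^ (a + d) / (u : ℚ) ^ a) x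
        = altSum S (fun u => 1 / (u : ℚ) ^ a) x * ((x : ℚ) ^ a * e) := by
    intro x
    by_cases hx : x ∈ S
    · obtain ⟨e, he⟩ := exists_altSum_lcm_pow_eq_mul hS hpos hG had hm hx
      exact ⟨e, fun _ => he⟩
    · exact ⟨0, fun h => absurd h hx⟩
  choose e he using he
  obtain ⟨c, hc⟩ := exists_sum_multiples_eq S hpos a e
  refine ⟨c, fun u hu => ?_⟩
  have hu0 : (u : ℚ) ≠ 0 := by exact_mod_cast (hpos u hu).ne'
  have h1 := sum_altSum hS hpos (fun u => (Nat.lcm m u : ℚ) ^ (a + d) / (u : ℚ) ^ a) hu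
  have h2 : ∀ l ∈ S, (l : ℚ) ^ a * e l = ∑ k ∈ S with l ∣ k, (c k : ℚ) * (k : ℚ) ^ a := by
    intro l hl
    exact_mod_cast (hc l hl).symm
  rw [sum_congr rfl fun l hl => by
    rw [he l (mem_filter.mp hl).1, h2 l (mem_filter.mp hl).1]] at h1
  have h3 : ∀ k ∈ S, (Nat.lcm k u : ℚ) ^ a = (k : ℚ) ^ a * (u : ℚ) ^ a *
      ∑ l ∈ S with l ∣ k ∧ l ∣ u, altSum S (fun u => 1 / (u : ℚ) ^ a) l := by
    intro k hk
    have hg := sum_altSum hS hpos (fun u => 1 / (u : ℚ) ^ a) (hS k hk u hu)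
    simp only [Nat.dvd_gcd_iff] at hg
    have hg0 : (Nat.gcd k u : ℚ) ≠ 0 := by exact_mod_cast (hpos _ (hS k hk u hu)).ne'
    have hl : (Nat.gcd k u : ℚ) * Nat.lcm k u = k * u := by exact_mod_cast Nat.gcd_mul_lcm k u
    rw [hg, ← mul_pow, ← hl, mul_pow]
    field_simp
  have h4 : (Nat.lcm m u : ℚ) ^ (a + d) = ∑ k ∈ S, (c k : ℚ) * (Nat.lcm k u : ℚ) ^ a := by
    rw [eq_div_iff (pow_ne_zero _ hu0)] at h1
    have h5 : ∀ k ∈ S, (c k : ℚ) * (Nat.lcm k u : ℚ) ^ a = ∑ l ∈ S with l ∣ u,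
        if l ∣ k then altSum S (fun u => 1 / (u : ℚ) ^ a) l * (c k * (k : ℚ) ^ a) * (u : ℚ) ^ a
        else 0 := by
      intro k hk
      rw [h3 k hk, ← sum_filter, filter_filter, mul_sum, mul_sum]
      simp_rw [and_comm]
      exact sum_congr rfl fun l _ => by ring
    rw [← h1, sum_congr rfl h5, sum_comm, sum_mul]
    refine sum_congr rfl fun l _ => ?_
    rw [← sum_filter, mul_sum, sum_mul]
  exact_mod_cast h4

theorem power_lcm_divides_power_lcm
    (n a b : ℕ) (ha : 0 < a) (hb : 0 < b) (hab : a ∣ b)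
    (x : Fin n → ℕ) (hpos : ∀ i, 0 < x i) (hmono : StrictMono x)
    (hgcd : gcdClosed (Finset.image x Finset.univ))
    (hG : condG (Finset.image x Finset.univ))
    (hmax : (∀ i, (GTD (Finset.image x Finset.univ) (x i)).card ≤ 3) ∧
            (∃ i, (GTD (Finset.image x Finset.univ) (x i)).card = 3)) :
    ∃ A : Matrix (Fin n) (Fin n) ℤ,
      (Matrix.of fun i j => (Nat.lcm (x i) (x j) : ℤ) ^ b)
        = A * (Matrix.of fun i j => (Nat.lcm (x i) (x j) : ℤ) ^ a) := by
  have hpos' : ∀ y ∈ Finset.image x Finset.univ, 0 < y := by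
    simpa using hpos
  choose c hc using fun i => exists_sum_lcm_pow_eq hgcd hpos' hG hb hab
    (mem_image_of_mem x (mem_univ i))
  refine ⟨Matrix.of fun i k => c i (x k), ?_⟩
  ext i j
  simpa [Matrix.mul_apply, sum_image (hmono.injective.injOn)] using
    hc i (x j) (mem_image_of_mem x (mem_univ j))
end

section
/- Let a and b be positive integers with a ∣ b, let S be a gcd-closed set of distinct positive integers satisfying condition 𝒢, and let x_m ∈ S with G_S(x_m) = {x_{m₁}, x_{m₂}, x_{m₃}} consisting of exactly three elements; set x_{m_{ij}} := gcd(x_{m_i}, x_{m_j}) for 1 ≤ i < j ≤ 3 and x_{m₄} := gcd(x_{m₁}, x_{m₂}, x_{m₃}). Then the integer x_m^a − x_{m₁}^a − x_{m₂}^a − x_{m₃}^a + x_{m_{12}}^a + x_{m_{13}}^a + x_{m_{23}}^a − x_{m₄}^a divides the integer x_m^b − x_{m₁}^b − x_{m₂}^b − x_{m₃}^b + x_{m_{12}}^b + x_{m_{13}}^b + x_{m_{23}}^b − x_{m₄}^b. -/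
/-- Cofactors of two numbers whose least common multiple is positive are coprime. -/
theorem coprime_of_lcm_eq {x y z p q : ℕ} (hx : 0 < x) (hp : x = y * p) (hq : x = z * q)
    (h : Nat.lcm y z = x) : Nat.Coprime p q := by
  obtain ⟨r, hr⟩ := Nat.gcd_dvd_left p q
  obtain ⟨s, hs⟩ := Nat.gcd_dvd_right p q
  have hxr : x = Nat.gcd p q * (y * r) := by
    conv_lhs => rw [hp, hr]
    ring
  have hxs : x = Nat.gcd p q * (z * s) := by
    conv_lhs => rw [hq, hs]
    ring
  have hd : 0 < Nat.gcd p q := Nat.pos_of_mul_pos_right (hxr ▸ hx)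
  have hrs : y * r = z * s := Nat.eq_of_mul_eq_mul_left hd (hxr.symm.trans hxs)
  have hdvd : x ∣ y * r := h ▸ Nat.lcm_dvd (Dvd.intro _ rfl) (hrs ▸ Dvd.intro _ rfl)
  have hpos : 0 < y * r := Nat.pos_of_mul_pos_left (hxr ▸ hx)
  have hle := Nat.le_of_dvd hpos hdvd
  have : Nat.gcd p q ≤ 1 := by
    by_contra! hlt
    nlinarith
  exact le_antisymm this hd

/-- Three divisors of `x` with pairwise least common multiple `x` are, up to a common factor `g`,
the pairwise products of three pairwise coprime numbers. -/
theorem exists_factorization_of_lcm_eq {x y₁ y₂ y₃ : ℕ} (hx : 0 < x)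
    (h₁₂ : Nat.lcm y₁ y₂ = x) (h₁₃ : Nat.lcm y₁ y₃ = x) (h₂₃ : Nat.lcm y₂ y₃ = x) :
    ∃ g p q r : ℕ, Nat.Coprime p q ∧ Nat.Coprime p r ∧ Nat.Coprime q r ∧
      x = g * p * q * r ∧ y₁ = g * q * r ∧ y₂ = g * p * r ∧ y₃ = g * p * q := by
  obtain ⟨p, hp⟩ : y₁ ∣ x := h₁₂ ▸ Nat.dvd_lcm_left _ _
  obtain ⟨q, hq⟩ : y₂ ∣ x := h₁₂ ▸ Nat.dvd_lcm_right _ _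
  obtain ⟨r, hr⟩ : y₃ ∣ x := h₁₃ ▸ Nat.dvd_lcm_right _ _
  have hpq := coprime_of_lcm_eq hx hp hq h₁₂
  have hpr := coprime_of_lcm_eq hx hp hr h₁₃
  have hqr := coprime_of_lcm_eq hx hq hr h₂₃
  obtain ⟨g, hg⟩ : p * q * r ∣ x :=
    (hpr.mul_left hqr).mul_dvd_of_dvd_of_dvd
      (hpq.mul_dvd_of_dvd_of_dvd (Dvd.intro_left _ hp.symm) (Dvd.intro_left _ hq.symm))
      (Dvd.intro_left _ hr.symm)
  refine ⟨g, p, q, r, hpq, hpr, hqr, by rw [hg]; ring, ?_, ?_, ?_⟩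
  · exact Nat.eq_of_mul_eq_mul_right (Nat.pos_of_mul_pos_left (hp ▸ hx)) (by rw [← hp, hg]; ring)
  · exact Nat.eq_of_mul_eq_mul_right (Nat.pos_of_mul_pos_left (hq ▸ hx)) (by rw [← hq, hg]; ring)
  · exact Nat.eq_of_mul_eq_mul_right (Nat.pos_of_mul_pos_left (hr ▸ hx)) (by rw [← hr, hg]; ring)


open Finset

theorem alpha_a_dvd_alpha_b
    (a b : ℕ) (ha : 0 < a) (hb : 0 < b) (hab : a ∣ b)
    (S : Finset ℕ) (hpos : ∀ u ∈ S, 0 < u) (hgcd : gcdClosed S) (hG : condG S)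
    (xm y₁ y₂ y₃ : ℕ) (hm : xm ∈ S)
    (hGTD : GTD S xm = {y₁, y₂, y₃}) (hcard : ({y₁, y₂, y₃} : Finset ℕ).card = 3) :
    ((xm : ℤ) ^ a - (y₁ : ℤ) ^ a - (y₂ : ℤ) ^ a - (y₃ : ℤ) ^ a
      + (Nat.gcd y₁ y₂ : ℤ) ^ a + (Nat.gcd y₁ y₃ : ℤ) ^ a + (Nat.gcd y₂ y₃ : ℤ) ^ a
      - (Nat.gcd (Nat.gcd y₁ y₂) y₃ : ℤ) ^ a) ∣
    ((xm : ℤ) ^ b - (y₁ : ℤ) ^ b - (y₂ : ℤ) ^ b - (y₃ : ℤ) ^ b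
      + (Nat.gcd y₁ y₂ : ℤ) ^ b + (Nat.gcd y₁ y₃ : ℤ) ^ b + (Nat.gcd y₂ y₃ : ℤ) ^ b
      - (Nat.gcd (Nat.gcd y₁ y₂) y₃ : ℤ) ^ b) := by
  have hmem : ∀ y, y ∈ GTD S xm ↔ y = y₁ ∨ y = y₂ ∨ y = y₃ := by simp [hGTD]
  obtain ⟨h₁₂, h₁₃, h₂₃⟩ : y₁ ≠ y₂ ∧ y₁ ≠ y₃ ∧ y₂ ≠ y₃ := by
    refine ⟨?_, ?_, ?_⟩ <;> rintro rfl <;>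
      simp [Finset.card_insert_eq_ite] at hcard <;> split_ifs at hcard <;> omega
  have m₁ : y₁ ∈ GTD S xm := by simp [hmem]
  have m₂ : y₂ ∈ GTD S xm := by simp [hmem]
  have m₃ : y₃ ∈ GTD S xm := by simp [hmem]
  obtain ⟨g, p, q, r, hpq, hpr, hqr, rfl, rfl, rfl, rfl⟩ :=
    exists_factorization_of_lcm_eq (hpos xm hm) (hG xm hm _ m₁ _ m₂ h₁₂).1
      (hG xm hm _ m₁ _ m₃ h₁₃).1 (hG xm hm _ m₂ _ m₃ h₂₃).1
  have g₁₂ : Nat.gcd (g * q * r) (g * p * r) = g * r := by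
    rw [Nat.gcd_mul_right, Nat.gcd_mul_left, hpq.symm.gcd_eq_one, mul_one]
  have g₁₃ : Nat.gcd (g * q * r) (g * p * q) = g * q := by
    rw [mul_right_comm g q r, Nat.gcd_mul_right, Nat.gcd_mul_left, hpr.symm.gcd_eq_one, mul_one]
  have g₂₃ : Nat.gcd (g * p * r) (g * p * q) = g * p := by
    rw [Nat.gcd_mul_left, hqr.symm.gcd_eq_one, mul_one]
  have g₁₂₃ : Nat.gcd (g * r) (g * p * q) = g := by
    rw [mul_assoc, Nat.gcd_mul_left, (hpr.symm.mul_right hqr.symm).gcd_eq_one, mul_one]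
  rw [g₁₂, g₁₃, g₂₃, g₁₂₃]
  have key (n : ℕ) : ((g * p * q * r : ℕ) : ℤ) ^ n - ((g * q * r : ℕ) : ℤ) ^ n
      - ((g * p * r : ℕ) : ℤ) ^ n - ((g * p * q : ℕ) : ℤ) ^ n + ((g * r : ℕ) : ℤ) ^ n
      + ((g * q : ℕ) : ℤ) ^ n + ((g * p : ℕ) : ℤ) ^ n - (g : ℤ) ^ n
      = (g : ℤ) ^ n * ((p : ℤ) ^ n - 1) * ((q : ℤ) ^ n - 1) * ((r : ℤ) ^ n - 1) := by
    push_cast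
    simp only [mul_pow]
    ring
  have hsub (z : ℤ) : z ^ a - 1 ∣ z ^ b - 1 := by
    obtain ⟨c, rfl⟩ := hab
    rw [pow_mul]
    simpa using sub_dvd_pow_sub_pow (z ^ a) 1 c
  rw [key a, key b]
  exact mul_dvd_mul (mul_dvd_mul (mul_dvd_mul (pow_dvd_pow _ (Nat.le_of_dvd hb hab))
    (hsub p)) (hsub q)) (hsub r)
end
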